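/- Let 1 < p < ∞ and let f : ℝⁿ → ℝ be continuously differentiable with ∫_{ℝⁿ} |∇f(x)|ᵖ dx < ∞. Then there is a constant C = C(n,p) such that sup_{λ>0} λᵖ ∑_{Q∈𝒟 : O(f,Q) > λ} ℓ(Q)^{−p} |Q| ≤ C · ∫_{ℝⁿ} |∇f|ᵖ dx, i.e. ‖f‖_{𝒪ᵖ(ℝⁿ)} ≲ ‖∇f‖_{Lᵖ(ℝⁿ)}. -/

import Mathlib

open MeasureTheory Set
open scoped ENNReal Classical

noncomputable section

/-- The half-open dyadic cube in `ℝⁿ` of generation `k` (sidelength `2 ^ k`) and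
corner index `j`, i.e. `∏ᵢ [jᵢ 2ᵏ, (jᵢ+1) 2ᵏ)`. -/
def dyadicCube (n : ℕ) (k : ℤ) (j : Fin n → ℤ) : Set (Fin n → ℝ) :=
  Set.univ.pi fun i => Set.Ico ((j i : ℝ) * 2 ^ k) (((j i : ℝ) + 1) * 2 ^ k)

/-- The mean oscillation `O(f,E) = ⨍_E |f - ⨍_E f|` (w.r.t. Lebesgue measure). -/
def osc {n : ℕ} (f : (Fin n → ℝ) → ℝ) (E : Set (Fin n → ℝ)) : ℝ :=
  ⨍ x in E, |f x - ⨍ y in E, f y|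

lemma enorm_sub_le_lintegral_segment {E : Type*} [NormedAddCommGroup E] [NormedSpace ℝ E]
    {f : E → ℝ} (hf : ContDiff ℝ 1 f) (x y : E) :
    ‖f y - f x‖ₑ ≤ ‖y - x‖ₑ * ∫⁻ t in Icc (0 : ℝ) 1, ‖fderiv ℝ f (x + t • (y - x))‖ₑ := by
  have hline : ContDiff ℝ 1 fun t : ℝ => x + t • (y - x) := by fun_prop
  have h := enorm_sub_le_lintegral_deriv_of_contDiffOn_Icc (a := (0 : ℝ)) (b := 1)
    (hf.comp hline).contDiffOn zero_le_one
  have hderiv (t : ℝ) : deriv (f ∘ fun t : ℝ => x + t • (y - x)) t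
      = fderiv ℝ f (x + t • (y - x)) (y - x) := by
    have h1 : HasDerivAt (fun t : ℝ => x + t • (y - x)) (y - x) t := by
      simpa using ((hasDerivAt_id t).smul_const (y - x)).const_add x
    exact (((hf.differentiable (by simp)) _).hasFDerivAt.comp_hasDerivAt t h1).deriv
  simp only [hderiv, Function.comp_apply, one_smul, zero_smul, add_zero,
    add_sub_cancel] at h
  refine h.trans ?_
  rw [← lintegral_const_mul' _ _ enorm_ne_top]
  refine lintegral_mono fun t => ?_
  rw [mul_comm]
  exact ContinuousLinearMap.le_opENorm _ _

section Poincare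

variable {E : Type*} [NormedAddCommGroup E] [NormedSpace ℝ E] [FiniteDimensional ℝ E]
  [MeasurableSpace E] [BorelSpace E] (μ : Measure E) [μ.IsAddHaarMeasure]

lemma lintegral_comp_add_smul {F : E → ℝ≥0∞} (hF : Measurable F) (c : E) {t : ℝ} (ht : t ≠ 0) :
    ∫⁻ y, F (c + t • y) ∂μ =
      ENNReal.ofReal |(t ^ Module.finrank ℝ E)⁻¹| * ∫⁻ y, F y ∂μ := by
  have h1 : ∫⁻ y, F (c + t • y) ∂μ = ∫⁻ z, F (c + z) ∂(Measure.map (t • ·) μ) :=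
    (lintegral_map (f := fun z => F (c + z)) (by fun_prop) (by fun_prop)).symm
  rw [h1, Measure.map_addHaar_smul μ ht, lintegral_smul_measure, lintegral_add_left_eq_self,
    smul_eq_mul]

/-- Averaging over the points at parameter `t ≥ 1 / 2` of the segments joining a fixed point of a
convex set to its other points. -/
lemma setLIntegral_segment_le {Q : Set E} (hQ : MeasurableSet Q) (hc : Convex ℝ Q)
    {g : E → ℝ≥0∞} (hg : Measurable g) {x : E} (hx : x ∈ Q) {t : ℝ} (ht : 1 / 2 ≤ t)
    (ht1 : t ≤ 1) :
    ∫⁻ y in Q, g (x + t • (y - x)) ∂μ ≤ 2 ^ Module.finrank ℝ E * ∫⁻ y in Q, g y ∂μ := by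
  have ht0 : 0 < t := by linarith
  calc ∫⁻ y in Q, g (x + t • (y - x)) ∂μ
      ≤ ∫⁻ y, Q.indicator g ((1 - t) • x + t • y) ∂μ := by
        rw [← lintegral_indicator hQ]
        refine lintegral_mono fun y => ?_
        by_cases hy : y ∈ Q
        · have hmem : (1 - t) • x + t • y ∈ Q := hc hx hy (by linarith) ht0.le (by ring)
          rw [indicator_of_mem hy, indicator_of_mem hmem]
          refine le_of_eq (congrArg g ?_)
          module
        · simp [hy]
    _ = ENNReal.ofReal |(t ^ Module.finrank ℝ E)⁻¹| * ∫⁻ y in Q, g y ∂μ := by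
        rw [lintegral_comp_add_smul μ (hg.indicator hQ) _ ht0.ne', lintegral_indicator hQ]
    _ ≤ _ := by
        gcongr
        rw [abs_of_pos (by positivity), ← inv_pow, ENNReal.ofReal_pow (by positivity)]
        gcongr
        refine ENNReal.ofReal_le_of_le_toReal ?_
        rw [ENNReal.toReal_ofNat, inv_le_comm₀ ht0 two_pos]
        linarith

lemma lintegral_lintegral_segment_le {Q : Set E} (hQ : MeasurableSet Q) (hc : Convex ℝ Q)
    {g : E → ℝ≥0∞} (hg : Measurable g) {t : ℝ} (ht0 : 0 ≤ t) (ht1 : t ≤ 1) :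
    ∫⁻ x in Q, ∫⁻ y in Q, g (x + t • (y - x)) ∂μ ∂μ
      ≤ 2 ^ Module.finrank ℝ E * (∫⁻ y in Q, g y ∂μ) * μ Q := by
  have key : ∀ s : ℝ, 1 / 2 ≤ s → s ≤ 1 → ∫⁻ x in Q, ∫⁻ y in Q, g (x + s • (y - x)) ∂μ ∂μ
      ≤ 2 ^ Module.finrank ℝ E * (∫⁻ y in Q, g y ∂μ) * μ Q := fun s hs hs1 =>
    calc _ ≤ ∫⁻ _ in Q, 2 ^ Module.finrank ℝ E * ∫⁻ y in Q, g y ∂μ ∂μ :=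
          setLIntegral_mono' hQ fun x hx => setLIntegral_segment_le μ hQ hc hg hx hs hs1
      _ = _ := setLIntegral_const _ _
  rcases le_total (1 / 2) t with h | h
  · exact key t h ht1
  · rw [lintegral_lintegral_swap (by fun_prop)]
    refine le_trans (le_of_eq ?_) (key (1 - t) (by linarith) (by linarith))
    refine lintegral_congr fun x => lintegral_congr fun y => congrArg g ?_
    module

lemma lintegral_lintegral_enorm_sub_le {Q : Set E} (hQ : MeasurableSet Q) (hc : Convex ℝ Q)
    {d : ℝ≥0∞} (hd : ∀ x ∈ Q, ∀ y ∈ Q, ‖y - x‖ₑ ≤ d) {f : E → ℝ} (hf : ContDiff ℝ 1 f) :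
    ∫⁻ x in Q, ∫⁻ y in Q, ‖f y - f x‖ₑ ∂μ ∂μ
      ≤ d * (2 ^ Module.finrank ℝ E * (∫⁻ y in Q, ‖fderiv ℝ f y‖ₑ ∂μ) * μ Q) := by
  have hcont : Continuous (fderiv ℝ f) := hf.continuous_fderiv (by simp)
  have hg : Measurable fun z => ‖fderiv ℝ f z‖ₑ := hcont.enorm.measurable
  calc ∫⁻ x in Q, ∫⁻ y in Q, ‖f y - f x‖ₑ ∂μ ∂μ
      ≤ ∫⁻ x in Q, ∫⁻ y in Q, d * (∫⁻ t in Icc (0 : ℝ) 1,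
          ‖fderiv ℝ f (x + t • (y - x))‖ₑ) ∂μ ∂μ := by
        refine setLIntegral_mono' hQ fun x hx => setLIntegral_mono' hQ fun y hy => ?_
        exact (enorm_sub_le_lintegral_segment hf x y).trans (by gcongr; exact hd x hx y hy)
    _ = d * ∫⁻ t in Icc (0 : ℝ) 1, ∫⁻ x in Q, ∫⁻ y in Q,
          ‖fderiv ℝ f (x + t • (y - x))‖ₑ ∂μ ∂μ := by
        have hm : Measurable fun q : (E × E) × ℝ =>
            ‖fderiv ℝ f (q.1.1 + q.2 • (q.1.2 - q.1.1))‖ₑ :=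
          hg.comp (by fun_prop)
        have h1 (x : E) : ∫⁻ y in Q, d * (∫⁻ t in Icc (0 : ℝ) 1,
            ‖fderiv ℝ f (x + t • (y - x))‖ₑ) ∂μ
            = d * ∫⁻ t in Icc (0 : ℝ) 1, ∫⁻ y in Q, ‖fderiv ℝ f (x + t • (y - x))‖ₑ ∂μ := by
          have hx : Measurable fun q : E × ℝ => ‖fderiv ℝ f (x + q.2 • (q.1 - x))‖ₑ :=
            hg.comp (by fun_prop)
          rw [lintegral_const_mul _ hx.lintegral_prod_right',
            lintegral_lintegral_swap hx.aemeasurable]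
        simp_rw [h1]
        have hm2 : Measurable fun q : E × ℝ =>
            ∫⁻ y in Q, ‖fderiv ℝ f (q.1 + q.2 • (y - q.1))‖ₑ ∂μ := by
          refine Measurable.lintegral_prod_right'
            (f := fun r : (E × ℝ) × E => ‖fderiv ℝ f (r.1.1 + r.1.2 • (r.2 - r.1.1))‖ₑ) ?_
          exact hg.comp (by fun_prop)
        rw [lintegral_const_mul _ hm2.lintegral_prod_right',
          lintegral_lintegral_swap hm2.aemeasurable]
    _ ≤ d * ∫⁻ _ in Icc (0 : ℝ) 1,
          2 ^ Module.finrank ℝ E * (∫⁻ y in Q, ‖fderiv ℝ f y‖ₑ ∂μ) * μ Q := by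
        refine mul_le_mul_right ?_ d
        refine setLIntegral_mono' measurableSet_Icc fun t ht => ?_
        exact lintegral_lintegral_segment_le μ hQ hc hg ht.1 ht.2
    _ = _ := by simp

end Poincare

lemma ofReal_integral_abs_sub_integral_le {α : Type*} [MeasurableSpace α] {μ : Measure α}
    [IsProbabilityMeasure μ] {f : α → ℝ} (hf : Integrable f μ) :
    ENNReal.ofReal (∫ x, |f x - ∫ y, f y ∂μ| ∂μ) ≤ ∫⁻ x, ∫⁻ y, ‖f y - f x‖ₑ ∂μ ∂μ := by
  have hint : Integrable (fun x => |f x - ∫ y, f y ∂μ|) μ := (hf.sub (integrable_const _)).abs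
  rw [ofReal_integral_eq_lintegral_ofReal hint (ae_of_all _ fun x => abs_nonneg _)]
  refine lintegral_mono fun x => ?_
  have h : f x - ∫ y, f y ∂μ = ∫ y, (f x - f y) ∂μ := by
    rw [integral_sub (integrable_const _) hf]; simp
  rw [← Real.norm_eq_abs, ofReal_norm, h]
  refine (enorm_integral_le_lintegral_enorm _).trans (lintegral_mono fun y => ?_)
  rw [← enorm_neg, neg_sub]

lemma measurableSet_dyadicCube (n : ℕ) (k : ℤ) (j : Fin n → ℤ) :
    MeasurableSet (dyadicCube n k j) :=
  MeasurableSet.univ_pi fun _ => measurableSet_Ico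

lemma convex_dyadicCube (n : ℕ) (k : ℤ) (j : Fin n → ℤ) : Convex ℝ (dyadicCube n k j) :=
  convex_pi fun _ _ => convex_Ico _ _

lemma volume_dyadicCube (n : ℕ) (k : ℤ) (j : Fin n → ℤ) :
    volume (dyadicCube n k j) = ENNReal.ofReal (2 ^ k) ^ n := by
  rw [dyadicCube, Real.volume_pi_Ico]
  simp [add_mul]

lemma enorm_sub_le_of_mem_dyadicCube {n : ℕ} {k : ℤ} {j : Fin n → ℤ} {x y : Fin n → ℝ}
    (hx : x ∈ dyadicCube n k j) (hy : y ∈ dyadicCube n k j) :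
    ‖y - x‖ₑ ≤ ENNReal.ofReal (2 ^ k) := by
  rw [← ofReal_norm]
  refine ENNReal.ofReal_le_ofReal ((pi_norm_le_iff_of_nonneg (by positivity)).2 fun i => ?_)
  have h1 := hx i (mem_univ i)
  have h2 := hy i (mem_univ i)
  simp only [mem_Ico] at h1 h2
  rw [Real.norm_eq_abs, Pi.sub_apply, abs_le]
  constructor <;> linarith

lemma pairwise_disjoint_dyadicCube (n : ℕ) (k : ℤ) :
    Pairwise (Function.onFun Disjoint (dyadicCube n k)) := by
  intro j j' hne
  refine Set.disjoint_left.2 fun x hx hx' => hne (funext fun i => ?_)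
  have h1 := hx i (mem_univ i)
  have h2 := hx' i (mem_univ i)
  simp only [mem_Ico] at h1 h2
  have h2k : (0 : ℝ) < 2 ^ k := by positivity
  have a : (j i : ℝ) < j' i + 1 := lt_of_mul_lt_mul_right (h1.1.trans_lt h2.2) h2k.le
  have b : (j' i : ℝ) < j i + 1 := lt_of_mul_lt_mul_right (h2.1.trans_lt h1.2) h2k.le
  norm_cast at a b
  omega

lemma volume_dyadicCube_ne_top (n : ℕ) (k : ℤ) (j : Fin n → ℤ) :
    volume (dyadicCube n k j) ≠ ∞ := by
  rw [volume_dyadicCube]; finiteness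

lemma volume_dyadicCube_ne_zero (n : ℕ) (k : ℤ) (j : Fin n → ℤ) :
    volume (dyadicCube n k j) ≠ 0 := by
  rw [volume_dyadicCube]
  exact pow_ne_zero _ (ENNReal.ofReal_pos.2 (by positivity)).ne'

lemma integrableOn_dyadicCube {n : ℕ} {f : (Fin n → ℝ) → ℝ} (hf : Continuous f) (k : ℤ)
    (j : Fin n → ℤ) : IntegrableOn f (dyadicCube n k j) := by
  have hK : IsCompact (Set.univ.pi fun i : Fin n =>
      Set.Icc ((j i : ℝ) * 2 ^ k) (((j i : ℝ) + 1) * 2 ^ k)) :=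
    isCompact_univ_pi fun _ => isCompact_Icc
  exact (hf.continuousOn.integrableOn_compact hK).mono_set
    (Set.pi_mono fun _ _ => Ico_subset_Icc_self)

/-- The `L¹` Poincaré inequality on a dyadic cube. -/
lemma ofReal_osc_mul_volume_le {n : ℕ} {f : (Fin n → ℝ) → ℝ} (hf : ContDiff ℝ 1 f) (k : ℤ)
    (j : Fin n → ℤ) :
    ENNReal.ofReal (osc f (dyadicCube n k j)) * volume (dyadicCube n k j)
      ≤ ENNReal.ofReal (2 ^ k) * 2 ^ n * ∫⁻ x in dyadicCube n k j, ‖fderiv ℝ f x‖ₑ := by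
  set Q := dyadicCube n k j
  have hV0 : volume Q ≠ 0 := volume_dyadicCube_ne_zero n k j
  have hVt : volume Q ≠ ∞ := volume_dyadicCube_ne_top n k j
  set ν : Measure (Fin n → ℝ) := (volume Q)⁻¹ • volume.restrict Q with hν
  have : IsProbabilityMeasure ν := ⟨by simp [hν, ENNReal.inv_mul_cancel hV0 hVt]⟩
  have hint : Integrable f ν :=
    (integrableOn_dyadicCube hf.continuous k j).smul_measure (ENNReal.inv_ne_top.2 hV0)
  have hosc : osc f Q = ∫ x, |f x - ∫ y, f y ∂ν| ∂ν := by
    simp only [osc, setAverage_eq', hν]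
  have h := ofReal_integral_abs_sub_integral_le hint
  have hP := lintegral_lintegral_enorm_sub_le volume (measurableSet_dyadicCube n k j)
    (convex_dyadicCube n k j) (fun x hx y hy => enorm_sub_le_of_mem_dyadicCube hx hy) hf
  rw [Module.finrank_fin_fun] at hP
  rw [← hosc] at h
  simp only [hν, lintegral_smul_measure, smul_eq_mul] at h
  rw [lintegral_const_mul' _ _ (ENNReal.inv_ne_top.2 hV0)] at h
  calc _ ≤ ((volume Q)⁻¹ * ((volume Q)⁻¹ * (ENNReal.ofReal (2 ^ k) *
        (2 ^ n * (∫⁻ y in Q, ‖fderiv ℝ f y‖ₑ) * volume Q)))) * volume Q := by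
        gcongr; exact h.trans (by gcongr)
    _ = (volume Q * (volume Q)⁻¹) * (volume Q * (volume Q)⁻¹) * (ENNReal.ofReal (2 ^ k) *
        2 ^ n * (∫⁻ y in Q, ‖fderiv ℝ f y‖ₑ)) := by ring
    _ = _ := by rw [ENNReal.mul_inv_cancel hV0 hVt]; simp

/-- A set on which `g` has mean at least `2 s` carries a controlled amount of `g` above the
level `s`. -/
lemma mul_measure_le_setLIntegral_of_two_mul_le {α : Type*} [MeasurableSpace α] {μ : Measure α}
    {g : α → ℝ≥0∞} {Q : Set α} (hQ : μ Q ≠ ∞) {s : ℝ≥0∞} (hs : s ≠ ∞)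
    (h : 2 * s * μ Q ≤ ∫⁻ x in Q, g x ∂μ) :
    s * μ Q ≤ ∫⁻ x in Q, {x | s < g x}.indicator g x ∂μ := by
  have h1 : ∫⁻ x in Q, g x ∂μ ≤ (∫⁻ x in Q, {x | s < g x}.indicator g x ∂μ) + s * μ Q := by
    rw [← setLIntegral_const, ← lintegral_add_right _ measurable_const]
    refine lintegral_mono fun x => ?_
    by_cases hx : s < g x
    · simp [indicator, hx]
    · simpa [indicator, hx] using not_lt.1 hx
  have h2 := h.trans h1
  rw [two_mul, add_mul] at h2
  exact (ENNReal.add_le_add_iff_right (by finiteness)).1 h2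

/-- Summing the powers `(a 2⁻ᵏ) ^ q` over the scales with `a 2⁻ᵏ < G` is a geometric series. -/
lemma tsum_zpow_rpow_le {q a G : ℝ} (hq : 0 < q) (ha : 0 < a) (hG : 0 ≤ G) :
    ∑' k : ℤ, (if a * 2 ^ (-k) < G then ENNReal.ofReal ((a * 2 ^ (-k)) ^ q) else 0)
      ≤ ENNReal.ofReal (G ^ q) * ENNReal.ofReal (1 - 2 ^ (-q))⁻¹ := by
  rcases hG.eq_or_lt with rfl | hG
  · have (k : ℤ) : ¬ a * 2 ^ (-k) < 0 := not_lt.2 (by positivity)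
    simp only [this, if_false, tsum_zero, zero_le]
  obtain ⟨m, hm1, hm2⟩ := exists_mem_Ioc_zpow (div_pos hG ha) one_lt_two
  rw [lt_div_iff₀ ha, mul_comm] at hm1
  rw [div_le_iff₀ ha, mul_comm] at hm2
  set F : ℤ → ℝ≥0∞ := fun k =>
    if a * 2 ^ (-k) < G then ENNReal.ofReal ((a * 2 ^ (-k)) ^ q) else 0
  have hinj : Function.Injective fun i : ℕ => -m + (i : ℤ) := fun i i' h => by
    simpa using h
  have hsupp : Function.support F ⊆ range fun i : ℕ => -m + (i : ℤ) := by
    intro k hk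
    have hk : a * 2 ^ (-k) < G := by
      by_contra hcon
      exact hk (if_neg hcon)
    have h1 : (2 : ℝ) ^ (-k) < 2 ^ (m + 1) := lt_of_mul_lt_mul_left (hk.trans_le hm2) ha.le
    have h2 := (zpow_lt_zpow_iff_right₀ one_lt_two).1 h1
    exact ⟨(k + m).toNat, by simp only; omega⟩
  have hr : (2 : ℝ) ^ (-q) < 1 := Real.rpow_lt_one_of_one_lt_of_neg one_lt_two (by linarith)
  have hr0 : (0 : ℝ) ≤ 2 ^ (-q) := by positivity
  rw [← hinj.tsum_eq hsupp]
  calc ∑' i : ℕ, F (-m + i) ≤ ∑' i : ℕ, ENNReal.ofReal (G ^ q * (2 ^ (-q)) ^ i) := by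
        refine ENNReal.tsum_le_tsum fun i => ?_
        refine le_trans (ite_le_sup _ _ _) (sup_le (ENNReal.ofReal_le_ofReal ?_) zero_le)
        have h1 : a * 2 ^ (-(-m + (i : ℤ))) = a * 2 ^ m * (2 ^ i)⁻¹ := by
          rw [show -(-m + (i : ℤ)) = m - i by ring, zpow_sub₀ two_ne_zero, zpow_natCast]; ring
        have h2 : ((2 : ℝ) ^ (-q)) ^ i = ((2 ^ i)⁻¹) ^ q := by
          rw [← Real.rpow_natCast, ← Real.rpow_mul two_pos.le, ← Real.rpow_natCast 2 i,
            ← Real.rpow_neg two_pos.le, ← Real.rpow_mul two_pos.le]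
          ring_nf
        rw [h1, h2, ← Real.mul_rpow hG.le (by positivity)]
        gcongr
    _ = _ := by
        rw [← ENNReal.ofReal_tsum_of_nonneg (fun i => by positivity)
          ((summable_geometric_of_lt_one hr0 hr).mul_left _), tsum_mul_left,
          tsum_geometric_of_lt_one hr0 hr, ENNReal.ofReal_mul (by positivity)]

/-- A dyadic cube of large oscillation is controlled by the part of the gradient above a
level comparable to the oscillation divided by the sidelength. -/
lemma ofReal_mul_volume_le_of_lt_osc {n : ℕ} {p : ℝ} {f : (Fin n → ℝ) → ℝ}
    (hf : ContDiff ℝ 1 f) {l : ℝ} (hl : 0 < l) {k : ℤ} {j : Fin n → ℤ}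
    (h : l < osc f (dyadicCube n k j)) :
    ENNReal.ofReal (l ^ p) * (ENNReal.ofReal (((2 : ℝ) ^ k) ^ (-p)) * volume (dyadicCube n k j))
      ≤ ENNReal.ofReal ((2 ^ (n + 1)) ^ p) *
        (ENNReal.ofReal ((l / 2 ^ (n + 1) * 2 ^ (-k)) ^ (p - 1)) *
        ∫⁻ x in dyadicCube n k j,
          {x | ENNReal.ofReal (l / 2 ^ (n + 1) * 2 ^ (-k)) < ‖fderiv ℝ f x‖ₑ}.indicator
            (fun x => ‖fderiv ℝ f x‖ₑ) x) := by
  set s : ℝ := l / 2 ^ (n + 1) * 2 ^ (-k) with hs_def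
  set Q := dyadicCube n k j
  have hs : 0 < s := by positivity
  have hls : l = 2 ^ k * 2 ^ n * (2 * s) := by
    rw [hs_def, zpow_neg]; field_simp; ring
  have hP : ENNReal.ofReal l * volume Q
      ≤ ENNReal.ofReal (2 ^ k) * 2 ^ n * ∫⁻ x in Q, ‖fderiv ℝ f x‖ₑ :=
    le_trans (by gcongr) (ofReal_osc_mul_volume_le hf k j)
  have hmean : 2 * ENNReal.ofReal s * volume Q ≤ ∫⁻ x in Q, ‖fderiv ℝ f x‖ₑ := by
    have hle : ENNReal.ofReal l = ENNReal.ofReal (2 ^ k) * 2 ^ n * (2 * ENNReal.ofReal s) := by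
      rw [hls, ENNReal.ofReal_mul (by positivity), ENNReal.ofReal_mul (by positivity),
        ENNReal.ofReal_mul (by positivity), ENNReal.ofReal_pow (by positivity),
        ENNReal.ofReal_ofNat]
    rw [hle, mul_assoc] at hP
    refine (ENNReal.mul_le_mul_iff_right ?_ ?_).1 hP
    · exact mul_ne_zero (ENNReal.ofReal_pos.2 (by positivity)).ne' (by simp)
    · finiteness
  have hlevel := mul_measure_le_setLIntegral_of_two_mul_le
    (volume_dyadicCube_ne_top n k j) ENNReal.ofReal_ne_top hmean
  have hpow : l ^ p * ((2 : ℝ) ^ k) ^ (-p) = (2 ^ (n + 1)) ^ p * (s ^ (p - 1) * s) := by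
    rw [Real.rpow_sub_one hs.ne', div_mul_cancel₀ _ hs.ne', Real.rpow_neg (by positivity),
      ← Real.inv_rpow (by positivity), ← Real.mul_rpow hl.le (by positivity),
      ← Real.mul_rpow (by positivity) hs.le, hs_def, zpow_neg]
    congr 1
    field_simp
  calc _ = ENNReal.ofReal ((2 ^ (n + 1)) ^ p) * (ENNReal.ofReal (s ^ (p - 1)) *
        (ENNReal.ofReal s * volume Q)) := by
        rw [← mul_assoc, ← ENNReal.ofReal_mul (by positivity), hpow,
          ENNReal.ofReal_mul (by positivity), ENNReal.ofReal_mul (by positivity)]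
        ring
    _ ≤ _ := by gcongr

/-- for `1 < p < ∞` and a continuously differentiable `f : ℝⁿ → ℝ` with
`∫ |∇f|^p < ∞`, one has `sup_{λ>0} λ^p ∑_{O(f,Q)>λ} ℓ(Q)^{-p}|Q| ≤ C ∫ |∇f|^p`,
i.e. `‖f‖_{𝒪^p(ℝⁿ)} ≲ ‖∇f‖_{L^p(ℝⁿ)}`. -/
theorem statement10 (n : ℕ) (p : ℝ) (hp : 1 < p) :
    ∃ C : ℝ, 0 < C ∧
      ∀ f : (Fin n → ℝ) → ℝ, ContDiff ℝ 1 f →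
      (∫⁻ x, ENNReal.ofReal (‖fderiv ℝ f x‖ ^ p)) < ∞ →
      (⨆ l ∈ Set.Ioi (0 : ℝ), ENNReal.ofReal (l ^ p) *
          ∑' Q : ℤ × (Fin n → ℤ),
            if l < osc f (dyadicCube n Q.1 Q.2) then
              ENNReal.ofReal (((2 : ℝ) ^ Q.1) ^ (-p)) * volume (dyadicCube n Q.1 Q.2) else 0)
        ≤ ENNReal.ofReal C * ∫⁻ x, ENNReal.ofReal (‖fderiv ℝ f x‖ ^ p) := by
  have hq : 0 < p - 1 := by linarith
  have hr : (2 : ℝ) ^ (-(p - 1)) < 1 :=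
    Real.rpow_lt_one_of_one_lt_of_neg one_lt_two (by linarith)
  have hr' : 0 < (1 - (2 : ℝ) ^ (-(p - 1)))⁻¹ := inv_pos.2 (by linarith)
  refine ⟨(2 ^ (n + 1)) ^ p * (1 - 2 ^ (-(p - 1)))⁻¹, by positivity, fun f hf _ => ?_⟩
  refine iSup₂_le fun l hl => ?_
  have hl : 0 < l := hl
  set g : (Fin n → ℝ) → ℝ≥0∞ := fun x => ‖fderiv ℝ f x‖ₑ with hg_def
  have hg : Measurable g := (hf.continuous_fderiv (by simp)).enorm.measurable
  set s : ℤ → ℝ := fun k => l / 2 ^ (n + 1) * 2 ^ (-k) with hs_def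
  have hs (k : ℤ) : 0 < s k := by simp only [hs_def]; positivity
  set u : ℤ → (Fin n → ℝ) → ℝ≥0∞ := fun k => {x | ENNReal.ofReal (s k) < g x}.indicator g
  have hu (k : ℤ) : Measurable (u k) := hg.indicator (measurableSet_lt measurable_const hg)
  have hpt (x : Fin n → ℝ) : ∑' k : ℤ, ENNReal.ofReal (s k ^ (p - 1)) * u k x
      ≤ ENNReal.ofReal (1 - 2 ^ (-(p - 1)))⁻¹ * ENNReal.ofReal (‖fderiv ℝ f x‖ ^ p) := by
    calc _ = (∑' k : ℤ, if s k < ‖fderiv ℝ f x‖ then ENNReal.ofReal (s k ^ (p - 1)) else 0)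
          * g x := by
          rw [← ENNReal.tsum_mul_right]
          refine tsum_congr fun k => ?_
          have hiff : ENNReal.ofReal (s k) < g x ↔ s k < ‖fderiv ℝ f x‖ := by
            simp only [hg_def, ← ofReal_norm]
            exact ENNReal.ofReal_lt_ofReal_iff_of_nonneg (hs k).le
          by_cases h : s k < ‖fderiv ℝ f x‖ <;> simp [u, hiff, h]
      _ ≤ (ENNReal.ofReal (‖fderiv ℝ f x‖ ^ (p - 1)) * ENNReal.ofReal (1 - 2 ^ (-(p - 1)))⁻¹)
          * g x := by
          gcongr
          exact tsum_zpow_rpow_le hq (by positivity) (norm_nonneg _)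
      _ = _ := by
          have hpow : ‖fderiv ℝ f x‖ ^ p = ‖fderiv ℝ f x‖ ^ (p - 1) * ‖fderiv ℝ f x‖ := by
            rw [← Real.rpow_add_one' (norm_nonneg _) (by linarith), sub_add_cancel]
          rw [hpow, ENNReal.ofReal_mul (by positivity), ofReal_norm]
          ring
  calc _ ≤ ∑' Q : ℤ × (Fin n → ℤ), ENNReal.ofReal ((2 ^ (n + 1)) ^ p) *
        (ENNReal.ofReal (s Q.1 ^ (p - 1)) * ∫⁻ x in dyadicCube n Q.1 Q.2, u Q.1 x) := by
        rw [← ENNReal.tsum_mul_left]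
        refine ENNReal.tsum_le_tsum fun Q => ?_
        split_ifs with h
        · exact ofReal_mul_volume_le_of_lt_osc hf hl h
        · simp
    _ = ENNReal.ofReal ((2 ^ (n + 1)) ^ p) * ∑' k : ℤ, ENNReal.ofReal (s k ^ (p - 1)) *
        ∑' j : Fin n → ℤ, ∫⁻ x in dyadicCube n k j, u k x := by
        simp_rw [ENNReal.tsum_mul_left, ENNReal.tsum_prod', ENNReal.tsum_mul_left]
    _ ≤ ENNReal.ofReal ((2 ^ (n + 1)) ^ p) * ∑' k : ℤ, ENNReal.ofReal (s k ^ (p - 1)) *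
        ∫⁻ x, u k x := by
        gcongr with k
        rw [← lintegral_iUnion (measurableSet_dyadicCube n k) (pairwise_disjoint_dyadicCube n k)]
        exact setLIntegral_le_lintegral _ _
    _ = ENNReal.ofReal ((2 ^ (n + 1)) ^ p) *
        ∫⁻ x, ∑' k : ℤ, ENNReal.ofReal (s k ^ (p - 1)) * u k x := by
        rw [lintegral_tsum fun k => ((hu k).const_mul _).aemeasurable]
        simp_rw [lintegral_const_mul _ (hu _)]
    _ ≤ ENNReal.ofReal ((2 ^ (n + 1)) ^ p) * (ENNReal.ofReal (1 - 2 ^ (-(p - 1)))⁻¹ *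
        ∫⁻ x, ENNReal.ofReal (‖fderiv ℝ f x‖ ^ p)) := by
        gcongr
        rw [← lintegral_const_mul' _ _ ENNReal.ofReal_ne_top]
        exact lintegral_mono hpt
    _ = _ := by rw [ENNReal.ofReal_mul (by positivity), mul_assoc]
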